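/- Let Φ be a translation invariant curvature measure on ℝⁿ, let B ⊆ ℝⁿ be a bounded set, let f : ℝⁿ → ℂ be a continuous function vanishing at infinity, and let (g_i) be a sequence of invertible linear maps of ℝⁿ converging to the identity. Then sup { |Φ(g_i⁻¹K, f∘g_i) − Φ(K, f)| : K a convex body with K ⊆ B } → 0 as i → ∞. -/

import Mathlib

open MeasureTheory Metric Filter Topology
open scoped Pointwise

/-- ℝⁿ as Euclidean space. -/
abbrev Rn (n : ℕ) := EuclideanSpace ℝ (Fin n)

/-- A convex body: a nonempty compact convex subset of ℝⁿ. -/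
def IsConvexBody {n : ℕ} (K : Set (Rn n)) : Prop :=
  K.Nonempty ∧ IsCompact K ∧ Convex ℝ K

/-- Integral of a complex-valued function against a finite complex Borel measure,
defined via the Jordan decompositions of the real and imaginary parts. -/
noncomputable def cmIntegral {n : ℕ} (μ : ComplexMeasure (Rn n)) (f : Rn n → ℂ) : ℂ :=
  ((∫ x, f x ∂(ComplexMeasure.re μ).toJordanDecomposition.posPart)
    - (∫ x, f x ∂(ComplexMeasure.re μ).toJordanDecomposition.negPart))
  + Complex.I * ((∫ x, f x ∂(ComplexMeasure.im μ).toJordanDecomposition.posPart)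
    - (∫ x, f x ∂(ComplexMeasure.im μ).toJordanDecomposition.negPart))

/-- The total variation measure of a finite complex Borel measure (a set is null for this
measure iff it is null for the classical total variation measure). -/
noncomputable def cmVariation {n : ℕ} (μ : ComplexMeasure (Rn n)) : Measure (Rn n) :=
  (ComplexMeasure.re μ).totalVariation + (ComplexMeasure.im μ).totalVariation

/-- A translation invariant curvature measure on ℝⁿ: a map assigning to each convex body
a finite complex Borel measure, which is local, translation invariant, and weakly continuous
with respect to Hausdorff convergence of convex bodies. -/
structure CurvatureMeasure (n : ℕ) where
  /-- the finite complex Borel measure associated to a convex body -/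
  meas : Set (Rn n) → ComplexMeasure (Rn n)
  locality : ∀ K L U : Set (Rn n), IsConvexBody K → IsConvexBody L → IsOpen U →
    K ∩ U = L ∩ U → ∀ β : Set (Rn n), MeasurableSet β → β ⊆ U → meas K β = meas L β
  translation_invariant : ∀ K : Set (Rn n), IsConvexBody K → ∀ x : Rn n,
    ∀ β : Set (Rn n), MeasurableSet β →
      meas ((fun y => y + x) '' K) ((fun y => y + x) '' β) = meas K β
  continuity : ∀ (Ki : ℕ → Set (Rn n)) (K : Set (Rn n)), (∀ i, IsConvexBody (Ki i)) →
    IsConvexBody K → Tendsto (fun i => hausdorffDist (Ki i) K) atTop (𝓝 0) →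
    ∀ f : BoundedContinuousFunction (Rn n) ℂ,
      Tendsto (fun i => cmIntegral (meas (Ki i)) f) atTop (𝓝 (cmIntegral (meas K) f))

/-- A curvature measure is homogeneous of degree `k`. -/
def CurvatureMeasure.Homogeneous {n : ℕ} (Φ : CurvatureMeasure n) (k : ℕ) : Prop :=
  ∀ t : ℝ, 0 < t → ∀ K : Set (Rn n), IsConvexBody K → ∀ β : Set (Rn n), MeasurableSet β →
    Φ.meas (t • K) (t • β) = (t : ℂ) ^ k * Φ.meas K β

/-- A curvature measure is SO(n) invariant: invariant under every orientation preserving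
linear isometry (rotation) of ℝⁿ. -/
def CurvatureMeasure.SOInvariant {n : ℕ} (Φ : CurvatureMeasure n) : Prop :=
  ∀ ρ : Rn n ≃ₗᵢ[ℝ] Rn n, 0 < LinearMap.det (ρ.toLinearEquiv : Rn n →ₗ[ℝ] Rn n) →
    ∀ K : Set (Rn n), IsConvexBody K → ∀ β : Set (Rn n), MeasurableSet β →
      Φ.meas (ρ '' K) (ρ '' β) = Φ.meas K β


theorem aux_convex {n : ℕ} (Ki : ℕ → Set (Rn n)) (K : Set (Rn n))
    (hKi : ∀ i, IsConvexBody (Ki i)) (hne : K.Nonempty) (hK : IsCompact K)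
    (h : Tendsto (fun i => hausdorffDist (Ki i) K) atTop (𝓝 0)) : Convex ℝ K := by
  intro x hx y hy a b ha hb hab
  rw [← hK.isClosed.closure_eq, Metric.mem_closure_iff]
  intro ε hε
  obtain ⟨i, hi⟩ := (h.eventually (gt_mem_nhds (half_pos hε))).exists
  have fin : hausdorffEDist (Ki i) K ≠ ⊤ :=
    hausdorffEDist_ne_top_of_nonempty_of_bounded (hKi i).1 hne (hKi i).2.1.isBounded hK.isBounded
  obtain ⟨x', hx', hxx⟩ := exists_dist_lt_of_hausdorffDist_lt' hx hi fin
  obtain ⟨y', hy', hyy⟩ := exists_dist_lt_of_hausdorffDist_lt' hy hi fin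
  obtain ⟨z, hz, hzz⟩ := exists_dist_lt_of_hausdorffDist_lt ((hKi i).2.2 hx' hy' ha hb hab) hi fin
  refine ⟨z, hz, ?_⟩
  have h1 : dist (a • x + b • y) (a • x' + b • y') ≤ a * dist x x' + b * dist y y' := by
    refine (dist_add_add_le _ _ _ _).trans ?_
    rw [dist_smul₀, dist_smul₀, Real.norm_of_nonneg ha, Real.norm_of_nonneg hb]
  have h2 := dist_triangle (a • x + b • y) (a • x' + b • y') z
  rw [dist_comm] at hxx hyy
  have h3 : a * dist x x' ≤ a * (ε / 2) := mul_le_mul_of_nonneg_left hxx.le ha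
  have h4 : b * dist y y' ≤ b * (ε / 2) := mul_le_mul_of_nonneg_left hyy.le hb
  have h5 : a * (ε / 2) + b * (ε / 2) = ε / 2 := by rw [← add_mul, hab, one_mul]
  linarith

theorem aux_blaschke {n : ℕ} (Ki : ℕ → Set (Rn n)) (hKi : ∀ i, IsConvexBody (Ki i)) (R : ℝ)
    (hR : ∀ i, Ki i ⊆ closedBall 0 R) :
    ∃ K : Set (Rn n), IsConvexBody K ∧ ∃ φ : ℕ → ℕ, StrictMono φ ∧
      Tendsto (fun i => hausdorffDist (Ki (φ i)) K) atTop (𝓝 0) := by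
  let C : ℕ → TopologicalSpace.NonemptyCompacts (Rn n) := fun i => ⟨⟨Ki i, (hKi i).2.1⟩, (hKi i).1⟩
  have hc := TopologicalSpace.NonemptyCompacts.isCompact_subsets_of_isCompact
    (isCompact_closedBall (0 : Rn n) R)
  obtain ⟨K, -, φ, hφ, hlim⟩ := hc.tendsto_subseq (x := C) (fun i => hR i)
  rw [tendsto_iff_dist_tendsto_zero] at hlim
  have hl : Tendsto (fun i => hausdorffDist (Ki (φ i)) K) atTop (𝓝 0) := hlim
  exact ⟨K, ⟨K.nonempty, K.isCompact, aux_convex _ K (fun i => hKi (φ i)) K.nonempty K.isCompact hl⟩,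
    φ, hφ, hl⟩

theorem aux_int {n : ℕ} (μ : Measure (Rn n)) [IsFiniteMeasure μ]
    (f : BoundedContinuousFunction (Rn n) ℂ) : Integrable (fun x => f x) μ :=
  f.integrable μ

theorem aux_clm {n : ℕ} (μ : ComplexMeasure (Rn n)) :
    ∃ T : BoundedContinuousFunction (Rn n) ℂ →L[ℂ] ℂ, ∀ f, T f = cmIntegral μ f := by
  have key : ∀ ν : Measure (Rn n), IsFiniteMeasure ν →
      ∃ T : BoundedContinuousFunction (Rn n) ℂ →L[ℂ] ℂ, ∀ f, T f = ∫ x, f x ∂ν := by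
    intro ν hν
    refine ⟨LinearMap.mkContinuous
      { toFun := fun f => ∫ x, f x ∂ν
        map_add' := fun f g => integral_add (aux_int ν f) (aux_int ν g)
        map_smul' := fun c f => integral_smul c _ } (ν.real Set.univ) ?_, fun f => rfl⟩
    intro f
    exact f.norm_integral_le_mul_norm ν
  obtain ⟨T1, h1⟩ := key (ComplexMeasure.re μ).toJordanDecomposition.posPart inferInstance
  obtain ⟨T2, h2⟩ := key (ComplexMeasure.re μ).toJordanDecomposition.negPart inferInstance
  obtain ⟨T3, h3⟩ := key (ComplexMeasure.im μ).toJordanDecomposition.posPart inferInstance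
  obtain ⟨T4, h4⟩ := key (ComplexMeasure.im μ).toJordanDecomposition.negPart inferInstance
  refine ⟨(T1 - T2) + Complex.I • (T3 - T4), fun f => ?_⟩
  simp [cmIntegral, h1, h2, h3, h4]

theorem aux_comp {n : ℕ} (f : ZeroAtInftyContinuousMap (Rn n) ℂ) (ε : ℝ) (hε : 0 < ε) :
    ∃ δ : ℝ, 0 < δ ∧ ∀ g : Rn n → Rn n, (∀ x, ‖g x - x‖ ≤ δ * ‖x‖) → ∀ x, ‖f (g x) - f x‖ ≤ ε := by
  have hu := Metric.uniformContinuous_iff.1 (ZeroAtInftyContinuousMap.uniformContinuous f) ε hε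
  obtain ⟨η, hη, hu⟩ := hu
  have hz := f.zero_at_infty'
  have hz2 : ∀ᶠ x in cocompact (Rn n), ‖f x‖ < ε / 2 := by
    have := hz.norm
    rw [norm_zero] at this
    exact this.eventually (gt_mem_nhds (half_pos hε))
  rw [← Metric.cobounded_eq_cocompact, ← comap_norm_atTop, eventually_comap] at hz2
  obtain ⟨R, hR⟩ := eventually_atTop.1 hz2
  have hR' : ∀ x, |R| ≤ ‖x‖ → ‖f x‖ < ε / 2 := fun x hx => hR ‖x‖ ((le_abs_self R).trans hx) x rfl
  have hRp : 0 < 2 * |R| + 1 := by positivity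
  refine ⟨min (1 / 2) (η / (2 * (2 * |R| + 1))), by positivity, fun g hg x => ?_⟩
  have hx := hg x
  by_cases hc : ‖x‖ ≤ 2 * |R|
  · refine le_of_lt ?_
    rw [← dist_eq_norm]
    apply hu
    rw [dist_eq_norm]
    calc ‖g x - x‖ ≤ _ := hx
      _ ≤ (η / (2 * (2 * |R| + 1))) * (2 * |R| + 1) := by
        gcongr
        · exact min_le_right _ _
        · linarith
      _ = η / 2 := by field_simp
      _ < η := by linarith
  · push Not at hc
    have h1 : ‖g x - x‖ ≤ 1 / 2 * ‖x‖ := hx.trans (by gcongr; exact min_le_left _ _)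
    have h2 : ‖x‖ ≤ ‖g x‖ + ‖g x - x‖ := by
      have := norm_sub_norm_le x (g x)
      rw [norm_sub_rev] at this
      linarith
    have h3 := hR' (g x) (by linarith)
    have h4 := hR' x (by linarith [abs_nonneg R])
    linarith [norm_sub_le (f (g x)) (f x)]

theorem aux_haus {n : ℕ} (K : Set (Rn n)) (R : ℝ) (hR0 : 0 ≤ R) (hR : K ⊆ closedBall 0 R)
    (g : Rn n ≃L[ℝ] Rn n) (δ : ℝ) (hδ0 : 0 ≤ δ) (hδ : δ ≤ 1 / 2)
    (hg : ∀ x, ‖g x - x‖ ≤ δ * ‖x‖) :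
    hausdorffDist (g.symm '' K) K ≤ δ * (2 * R) := by
  have key : ∀ x ∈ K, dist (g.symm x) x ≤ δ * (2 * R) := by
    intro x hx
    have h1 := hg (g.symm x)
    rw [g.apply_symm_apply] at h1
    have h2 : ‖x‖ ≤ R := by simpa using hR hx
    have h3 : δ * ‖g.symm x‖ ≤ 1 / 2 * ‖g.symm x‖ := by gcongr
    have h4 := norm_sub_norm_le (g.symm x) x
    rw [norm_sub_rev] at h4
    rw [dist_comm, dist_eq_norm]
    refine h1.trans ?_
    gcongr
    linarith
  refine hausdorffDist_le_of_mem_dist (by positivity) ?_ ?_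
  · rintro _ ⟨x, hx, rfl⟩
    exact ⟨x, hx, key x hx⟩
  · intro x hx
    exact ⟨g.symm x, ⟨x, hx, rfl⟩, by rw [dist_comm]; exact key x hx⟩

/-- Continuity of the GL(n,ℝ) action on curvature measures: if g_i → id in operator norm,
then Φ(g_i⁻¹K, f ∘ g_i) → Φ(K, f) uniformly over convex bodies K contained in a bounded
set B, for every continuous function f vanishing at infinity. -/
theorem curvatureMeasure_GL_action_continuous (n : ℕ) (Φ : CurvatureMeasure n)
    (B : Set (Rn n)) (hB : Bornology.IsBounded B)
    (f : ZeroAtInftyContinuousMap (Rn n) ℂ)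
    (g : ℕ → (Rn n ≃L[ℝ] Rn n))
    (hg : Tendsto (fun i => ‖((g i : Rn n →L[ℝ] Rn n) : Rn n →L[ℝ] Rn n)
      - ContinuousLinearMap.id ℝ (Rn n)‖) atTop (𝓝 0)) :
    ∀ ε : ℝ, 0 < ε → ∃ N : ℕ, ∀ i : ℕ, N ≤ i →
      ∀ K : Set (Rn n), IsConvexBody K → K ⊆ B →
        ‖cmIntegral (Φ.meas ((g i).symm '' K)) (fun x => f ((g i) x))
          - cmIntegral (Φ.meas K) (fun x => f x)‖ < ε := by
  intro ε hε
  by_contra hcon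
  push Not at hcon
  choose ι hι K hKb hKB hbad using hcon
  obtain ⟨R, hR0, hBR⟩ : ∃ R : ℝ, 0 ≤ R ∧ B ⊆ closedBall 0 R := by
    obtain ⟨R, hR⟩ := hB.subset_closedBall 0
    exact ⟨max R 0, le_max_right _ _, hR.trans (closedBall_subset_closedBall (le_max_left _ _))⟩
  obtain ⟨L, hL, φ, hφ, hlim⟩ := aux_blaschke K hKb R (fun i => (hKB i).trans hBR)
  set G : ℕ → (Rn n ≃L[ℝ] Rn n) := fun j => g (ι (φ j)) with hG
  have hιφ : Tendsto (fun j => ι (φ j)) atTop atTop :=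
    tendsto_atTop_mono (fun j => (hφ.id_le j).trans (hι (φ j))) tendsto_id
  have hG0 := hg.comp hιφ
  set d : ℕ → ℝ := fun j => ‖((G j : Rn n →L[ℝ] Rn n) : Rn n →L[ℝ] Rn n)
      - ContinuousLinearMap.id ℝ (Rn n)‖ with hd
  have hd0 : Tendsto d atTop (𝓝 0) := hG0
  have hGd : ∀ j x, ‖G j x - x‖ ≤ d j * ‖x‖ := fun j x =>
    ((G j : Rn n →L[ℝ] Rn n) - ContinuousLinearMap.id ℝ (Rn n)).le_opNorm x
  set M : ℕ → Set (Rn n) := fun j => (G j).symm '' K (φ j) with hM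
  have hMb : ∀ j, IsConvexBody (M j) := fun j =>
    ⟨(hKb _).1.image _, (hKb _).2.1.image (G j).symm.continuous,
      (hKb _).2.2.linear_image ((G j).symm : Rn n →ₗ[ℝ] Rn n)⟩
  have hMlim : Tendsto (fun j => hausdorffDist (M j) L) atTop (𝓝 0) := by
    have h1 : Tendsto (fun j => d j * (2 * R) + hausdorffDist (K (φ j)) L) atTop (𝓝 0) := by
      simpa using (hd0.mul_const (2 * R)).add hlim
    refine squeeze_zero' (Eventually.of_forall fun j => hausdorffDist_nonneg) ?_ h1
    filter_upwards [hd0.eventually (gt_mem_nhds (show (0 : ℝ) < 1 / 2 by norm_num))] with j hj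
    have fin : hausdorffEDist (M j) (K (φ j)) ≠ ⊤ :=
      hausdorffEDist_ne_top_of_nonempty_of_bounded (hMb j).1 (hKb _).1
        (hMb j).2.1.isBounded (hKb _).2.1.isBounded
    have h2 := aux_haus (K (φ j)) R hR0 ((hKB _).trans hBR) (G j) (d j) (norm_nonneg _) hj.le (hGd j)
    linarith [hausdorffDist_triangle (u := L) fin]
  choose T hT using fun j => aux_clm (Φ.meas (M j))
  let F : BoundedContinuousFunction (Rn n) ℂ := f.toBCF
  have hlimT : ∀ h : BoundedContinuousFunction (Rn n) ℂ,
      Tendsto (fun j => T j h) atTop (𝓝 (cmIntegral (Φ.meas L) h)) := by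
    intro h
    simp only [hT]
    exact Φ.continuity M L hMb hL hMlim h
  obtain ⟨C, hC⟩ := banach_steinhaus (g := T) (fun h => by
    obtain ⟨c, hc⟩ := (hlimT h).norm.bddAbove_range
    exact ⟨c, fun j => hc ⟨j, rfl⟩⟩)
  have hC0 : 0 ≤ C := (norm_nonneg _).trans (hC 0)
  let H : ℕ → BoundedContinuousFunction (Rn n) ℂ := fun j =>
    F.compContinuous ⟨G j, (G j).continuous⟩
  have e1 := hlimT F
  have e2 := Φ.continuity (fun j => K (φ j)) L (fun j => hKb _) hL hlim F
  have e3 := (e1.sub e2).norm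
  rw [sub_self, norm_zero] at e3
  obtain ⟨δ, hδ, hcomp⟩ := aux_comp f (ε / (2 * (C + 1))) (by positivity)
  obtain ⟨j, hj1, hj2⟩ := ((e3.eventually (gt_mem_nhds (half_pos hε))).and
    (hd0.eventually (gt_mem_nhds hδ))).exists
  have hHF : ‖H j - F‖ ≤ ε / (2 * (C + 1)) := by
    rw [BoundedContinuousFunction.norm_le (by positivity)]
    intro x
    refine hcomp (G j) (fun x => (hGd j x).trans ?_) x
    gcongr
  have h5 : ‖T j (H j) - T j F‖ ≤ ε / 2 := by
    rw [← map_sub]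
    refine ((T j).le_opNorm _).trans ?_
    calc ‖T j‖ * ‖H j - F‖ ≤ (C + 1) * (ε / (2 * (C + 1))) := by
          gcongr
          linarith [hC j]
      _ = ε / 2 := by field_simp
  have h6 := hbad (φ j)
  have h7 : cmIntegral (Φ.meas ((g (ι (φ j))).symm '' K (φ j))) (fun x => f ((g (ι (φ j))) x))
      = T j (H j) := (hT j (H j)).symm
  rw [h7] at h6
  have h8 : T j (H j) - cmIntegral (Φ.meas (K (φ j))) (fun x => f x)
      = (T j (H j) - T j F) + (T j F - cmIntegral (Φ.meas (K (φ j))) F) := by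
    rw [sub_add_sub_cancel]; rfl
  rw [h8] at h6
  have h9 := norm_add_le (T j (H j) - T j F) (T j F - cmIntegral (Φ.meas (K (φ j))) F)
  linarith
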